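/- arXiv:2605.19514 — 5 statements merged into one kernel-verified Lean document; each statement's English description precedes it below -/
import Mathlib

section
/- For every finite alphabet Σ (containing the distinguished tokens <s>, <EOS>, ACC, REJ), every integer N ≥ 3, and every next-token function f : Σ^{≤N} → Σ, if the summarization-style system determined by (N, f) halts on every input x ∈ Σ*, then the language {x ∈ Σ* : the system accepts x} is a regular language. -/
/-!
The summarization-style context-management system.

The alphabet is a finite type `A` containing distinguished tokens
`sTok` (`<s>`, summary instruction), `eosTok` (`<EOS>`), `accTok` (`ACC`),
`rejTok` (`REJ`).  `N` is the context-window length, and `f : List A → A`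
abstracts one decoding step of a fixed finite-precision Transformer with a
deterministic decoding rule (the system only ever evaluates `f` on strings
of length at most `N`).
-/

variable {A : Type} [DecidableEq A]

/-- The token decoded from the maintained string `r`:
in the normal phase (`|r| < N - 1`) it is `f r`; in the summarization phase
(`|r| ≥ N - 1`) it is `f (<s> · r₁ ⋯ r_{N-1})`. -/
def sumDec (N : ℕ) (sTok : A) (f : List A → A) (r : List A) : A :=
  if r.length < N - 1 then f r else f (sTok :: r.take (N - 1))

/-- One step of the summarization-style system: `none` means the system halts
(the decoded token in the normal phase was `<EOS>`). -/
def sumStep (N : ℕ) (sTok eosTok : A) (f : List A → A) (r : List A) :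
    Option (List A) :=
  if r.length < N - 1 then
    if f r = eosTok then none else some (r ++ [f r])
  else
    some (f (sTok :: r.take (N - 1)) :: r.drop (N - 1))

/-- `sumTraj N sTok eosTok f x t` is the maintained string `r⁽ᵗ⁺¹⁾` (so index `0`
corresponds to `r⁽¹⁾ = x`), or `none` if the system has halted by then. -/
def sumTraj (N : ℕ) (sTok eosTok : A) (f : List A → A) (x : List A) :
    ℕ → Option (List A)
  | 0 => some x
  | t + 1 => (sumTraj N sTok eosTok f x t).bind (sumStep N sTok eosTok f)

/-- The system halts on input `x`. -/
def sumHalts (N : ℕ) (sTok eosTok : A) (f : List A → A) (x : List A) : Prop :=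
  ∃ t, sumTraj N sTok eosTok f x t = none

/-- The system accepts `x`: at some step the decoded token is `ACC`. -/
def sumAccepts (N : ℕ) (sTok eosTok accTok : A) (f : List A → A)
    (x : List A) : Prop :=
  ∃ t r, sumTraj N sTok eosTok f x t = some r ∧ sumDec N sTok f r = accTok

theorem sumTraj_succ_eq (N : ℕ) (sTok eosTok : A) (f : List A → A) (x : List A) (t : ℕ) :
    sumTraj N sTok eosTok f x (t + 1) =
      (sumStep N sTok eosTok f x).bind fun y => sumTraj N sTok eosTok f y t := by
  induction t with
  | zero => simp [sumTraj]
  | succ t ih =>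
    rw [sumTraj, ih, Option.bind_assoc]
    rfl

theorem sumAccepts_iff_step (N : ℕ) (sTok eosTok accTok : A) (f : List A → A) (x : List A) :
    sumAccepts N sTok eosTok accTok f x ↔
      sumDec N sTok f x = accTok ∨
        ∃ y, sumStep N sTok eosTok f x = some y ∧ sumAccepts N sTok eosTok accTok f y := by
  constructor
  · rintro ⟨t, r, hr, hd⟩
    cases t with
    | zero =>
      obtain rfl : x = r := by simpa [sumTraj] using hr
      exact .inl hd
    | succ t =>
      rw [sumTraj_succ_eq, Option.bind_eq_some_iff] at hr
      obtain ⟨y, hy, hr⟩ := hr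
      exact .inr ⟨y, hy, t, r, hr, hd⟩
  · rintro (hd | ⟨y, hy, t, r, hr, hd⟩)
    · exact ⟨0, x, rfl, hd⟩
    · exact ⟨t + 1, r, by rw [sumTraj_succ_eq, hy]; exact hr, hd⟩

/-- A prefix filling the summarization window can be replaced by its summary token,
unless that token already accepts. -/
theorem sumAccepts_append_iff (N : ℕ) (sTok eosTok accTok : A) (f : List A → A)
    {w : List A} (hw : w.length = N - 1) (y : List A) :
    sumAccepts N sTok eosTok accTok f (w ++ y) ↔
      f (sTok :: w) = accTok ∨
        sumAccepts N sTok eosTok accTok f ([f (sTok :: w)] ++ y) := by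
  rw [sumAccepts_iff_step]
  simp [sumDec, sumStep, ← hw]

/-- The language accepted by the summarization-style system. -/
def sumLanguage (N : ℕ) (sTok eosTok accTok : A) (f : List A → A) : Language A :=
  {x | sumAccepts N sTok eosTok accTok f x}

/-- Every left quotient of the accepted language is everything or the left quotient by a
string shorter than the summarization window. -/
theorem leftQuotient_sumLanguage (N : ℕ) (hN : 3 ≤ N) (sTok eosTok accTok : A)
    (f : List A → A) (x : List A) :
    (sumLanguage N sTok eosTok accTok f).leftQuotient x ∈
      insert (Set.univ : Set (List A)) ((sumLanguage N sTok eosTok accTok f).leftQuotient ''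
        {b | b.length < N - 1}) := by
  induction x using List.reverseRecOn with
  | nil => exact .inr ⟨[], by simp; omega, rfl⟩
  | append_singleton x a ih =>
    rw [Language.leftQuotient_append]
    obtain h | ⟨b, hb, h⟩ := ih
    · rw [h]
      exact .inl rfl
    · rw [← h, ← Language.leftQuotient_append]
      rw [Set.mem_ofPred_eq] at hb
      by_cases hlt : (b ++ [a]).length < N - 1
      · exact .inr ⟨_, hlt, rfl⟩
      have hw : (b ++ [a]).length = N - 1 := by
        simp only [List.length_append, List.length_singleton] at hlt ⊢
        omega
      by_cases hc : f (sTok :: (b ++ [a])) = accTok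
      · exact .inl (Set.eq_univ_of_forall fun y =>
          (sumAccepts_append_iff N sTok eosTok accTok f hw y).2 (.inl hc))
      · refine .inr ⟨[f (sTok :: (b ++ [a]))], by simp; omega, Set.ext fun y => ?_⟩
        exact ((sumAccepts_append_iff N sTok eosTok accTok f hw y).trans
          (or_iff_right hc)).symm

theorem isRegular_sumLanguage [Finite A] (N : ℕ) (hN : 3 ≤ N) (sTok eosTok accTok : A)
    (f : List A → A) : (sumLanguage N sTok eosTok accTok f).IsRegular :=
  Language.IsRegular.of_finite_range_leftQuotient <|
    (((List.finite_length_lt A (N - 1)).image _).insert _).subset <|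
      Set.range_subset_iff.2 (leftQuotient_sumLanguage N hN sTok eosTok accTok f)

/-- For every finite alphabet (with the distinguished tokens
`<s>`, `<EOS>`, `ACC`, `REJ`), every `N ≥ 3` and every next-token function `f`,
if the summarization-style system determined by `(N, f)` halts on every input,
then the language it accepts is regular (accepted by a DFA with finitely many
states). -/
theorem summarization_system_accepts_regular_language
    (A : Type) [Fintype A] [DecidableEq A]
    (sTok eosTok accTok rejTok : A)
    (N : ℕ) (hN : 3 ≤ N) (f : List A → A)
    (hhalt : ∀ x : List A, sumHalts N sTok eosTok f x) :
    ∃ (σ : Type) (_ : Fintype σ) (M : DFA A σ),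
      ∀ x : List A, x ∈ M.accepts ↔ sumAccepts N sTok eosTok accTok f x := by
  obtain ⟨σ, hσ, M, hM⟩ := isRegular_sumLanguage N hN sTok eosTok accTok f
  exact ⟨σ, hσ, M, fun x => by rw [hM]; rfl⟩
end

section
/- Let Σ₀ ⊆ Σ \ {<s>, <EOS>, ACC, REJ} contain at least the symbols 0, 1, and #. There exist no integer N ≥ 3 and next-token function f : Σ^{≤N} → Σ such that the summarization-style system determined by (N, f) decides the palindrome language {w # reverse(w) : w ∈ {0,1}*} over Σ₀. -/
/-!
The summarization-style context-management system.

The alphabet is a finite type `A` containing distinguished tokens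
`sTok` (`<s>`, summary instruction), `eosTok` (`<EOS>`), `accTok` (`ACC`),
`rejTok` (`REJ`).  `N` is the context-window length, and `f : List A → A`
abstracts one decoding step of a fixed finite-precision Transformer with a
deterministic decoding rule (the system only ever evaluates `f` on strings
of length at most `N`).
-/

variable {A : Type} [DecidableEq A]

/-- The system rejects `x`: at some step the decoded token is `REJ`. -/
def sumRejects (N : ℕ) (sTok eosTok rejTok : A) (f : List A → A)
    (x : List A) : Prop :=
  ∃ t r, sumTraj N sTok eosTok f x t = some r ∧ sumDec N sTok f r = rejTok

/-- The system decides the language `L ⊆ Σ₀*`: on every input `x ∈ Σ₀*` it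
halts, it accepts `x` iff `x ∈ L`, and it rejects `x` iff `x ∉ L`. -/
def sumDecides (N : ℕ) (sTok eosTok accTok rejTok : A) (f : List A → A)
    (S₀ : Set A) (L : Set (List A)) : Prop :=
  ∀ x : List A, (∀ c ∈ x, c ∈ S₀) →
    sumHalts N sTok eosTok f x ∧
    (sumAccepts N sTok eosTok accTok f x ↔ x ∈ L) ∧
    (sumRejects N sTok eosTok rejTok f x ↔ x ∉ L)

/-- While a prefix `u` of length `1 + k * (N - 2)` is being summarized, the maintained string is
some `r`, depending only on `u`, followed by the unread suffix. -/
lemma exists_sumTraj_append (N : ℕ) (hN : 3 ≤ N) (sTok eosTok : A) (f : List A → A) (k : ℕ)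
    (u : List A) (hu : u.length = 1 + k * (N - 2)) (t : ℕ) (ht : t ≤ k) :
    ∃ r : List A, r.length = 1 + (k - t) * (N - 2) ∧
      ∀ v, sumTraj N sTok eosTok f (u ++ v) t = some (r ++ v) := by
  induction t with
  | zero => exact ⟨u, by simpa using hu, fun v => rfl⟩
  | succ t ih =>
    obtain ⟨r, hr, hv⟩ := ih (by omega)
    obtain ⟨d, hd⟩ : ∃ d, k - t = d + 1 := ⟨k - t - 1, by omega⟩
    have hd' : k - (t + 1) = d := by omega
    rw [hd, add_mul, one_mul] at hr
    refine ⟨f (sTok :: r.take (N - 1)) :: r.drop (N - 1), ?_, fun v => ?_⟩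
    · rw [hd', List.length_cons, List.length_drop, hr]
      omega
    · have hle : N - 1 ≤ r.length := by omega
      have hlt : ¬ (r ++ v).length < N - 1 := by
        rw [List.length_append]
        omega
      simp only [sumTraj, hv, Option.bind_some, sumStep, if_neg hlt,
        List.take_append_of_le_length hle, List.drop_append_of_le_length hle, List.cons_append]

lemma sumTraj_add_congr {N : ℕ} {sTok eosTok : A} {f : List A → A} {x y : List A} {k : ℕ}
    (h : sumTraj N sTok eosTok f x k = sumTraj N sTok eosTok f y k) (s : ℕ) :
    sumTraj N sTok eosTok f x (k + s) = sumTraj N sTok eosTok f y (k + s) := by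
  induction s with
  | zero => exact h
  | succ s ih => exact congrArg (Option.bind · (sumStep N sTok eosTok f)) ih

/-- If `u` and `u'` are summarized to the same token and `u ++ v` is accepted, then either every
extension of `u` is accepted, or `u' ++ v` is accepted. -/
lemma sumAccepts_append_or {N : ℕ} (hN : 3 ≤ N) {sTok eosTok accTok : A} {f : List A → A} {k : ℕ}
    {u u' v : List A} {a : A} (hu : u.length = 1 + k * (N - 2))
    (ha : sumTraj N sTok eosTok f (u ++ v) k = some (a :: v))
    (ha' : sumTraj N sTok eosTok f (u' ++ v) k = some (a :: v))
    (hacc : sumAccepts N sTok eosTok accTok f (u ++ v)) :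
    (∀ v', sumAccepts N sTok eosTok accTok f (u ++ v')) ∨
      sumAccepts N sTok eosTok accTok f (u' ++ v) := by
  obtain ⟨t, r, ht, hr⟩ := hacc
  rcases lt_or_ge t k with htk | hkt
  · left
    intro v'
    obtain ⟨q, hq, hqv⟩ := exists_sumTraj_append N hN sTok eosTok f k u hu t htk.le
    obtain ⟨d, hd⟩ : ∃ d, k - t = d + 1 := ⟨k - t - 1, by omega⟩
    rw [hd, add_mul, one_mul] at hq
    have hle : N - 1 ≤ q.length := by omega
    have hdec : ∀ z, sumDec N sTok f (q ++ z) = f (sTok :: q.take (N - 1)) := by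
      intro z
      have hlt : ¬ (q ++ z).length < N - 1 := by
        rw [List.length_append]
        omega
      rw [sumDec, if_neg hlt, List.take_append_of_le_length hle]
    refine ⟨t, q ++ v', hqv v', ?_⟩
    rw [hqv, Option.some_inj] at ht
    rw [hdec, ← hr, ← ht, hdec]
  · right
    obtain ⟨s, rfl⟩ := Nat.exists_eq_add_of_le hkt
    exact ⟨k + s, r, (sumTraj_add_congr (ha'.trans ha.symm) s).trans ht, hr⟩

/-- Let `Σ₀ ⊆ Σ \ {<s>, <EOS>, ACC, REJ}` contain at least the
(distinct) symbols `0`, `1`, `#`. No summarization-style system (for any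
`N ≥ 3` and next-token function `f`) decides the palindrome language
`{w # reverse(w) : w ∈ {0,1}*}` over `Σ₀`. -/
theorem no_summarization_system_decides_palindromes
    (A : Type) [Fintype A] [DecidableEq A]
    (sTok eosTok accTok rejTok : A) (c0 c1 chash : A) (S₀ : Set A)
    (hS₀ : ∀ a ∈ S₀, a ≠ sTok ∧ a ≠ eosTok ∧ a ≠ accTok ∧ a ≠ rejTok)
    (h0 : c0 ∈ S₀) (h1 : c1 ∈ S₀) (hh : chash ∈ S₀)
    (h01 : c0 ≠ c1) (h0h : c0 ≠ chash) (h1h : c1 ≠ chash) :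
    ¬ ∃ (N : ℕ) (f : List A → A), 3 ≤ N ∧
        sumDecides N sTok eosTok accTok rejTok f S₀
          {l | ∃ w : List A, (∀ c ∈ w, c = c0 ∨ c = c1) ∧
            l = w ++ chash :: w.reverse} := by
  rintro ⟨N, f, hN, hdec⟩
  let k := Fintype.card A
  let n := 1 + k * (N - 2)
  let word : (Fin n → Bool) → List A := fun g => List.ofFn fun i => if g i then c1 else c0
  have hlen : ∀ g, (word g).length = 1 + k * (N - 2) := fun g => List.length_ofFn
  have hword : ∀ g, ∀ c ∈ word g, c = c0 ∨ c = c1 := by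
    intro g c hc
    obtain ⟨i, rfl⟩ := List.mem_ofFn.1 hc
    split_ifs <;> simp
  have hinj : Function.Injective word := by
    intro g g' h
    funext i
    have hi := congrFun (List.ofFn_injective h) i
    cases hg : g i <;> cases hg' : g' i <;> simp_all
  have htok : ∀ g, ∃ a, ∀ v, sumTraj N sTok eosTok f (word g ++ v) k = some (a :: v) := by
    intro g
    obtain ⟨r, hr, hv⟩ := exists_sumTraj_append N hN sTok eosTok f k (word g) (hlen g) k le_rfl
    obtain ⟨a, rfl⟩ := List.length_eq_one_iff.1 (by simpa using hr)
    exact ⟨a, hv⟩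
  choose tok htok using htok
  have hcard : Fintype.card A < Fintype.card (Fin n → Bool) := by
    have hkn : k ≤ n := (Nat.le_mul_of_pos_right k (by omega)).trans (Nat.le_add_left _ 1)
    simpa using hkn.trans_lt n.lt_two_pow_self
  obtain ⟨g, g', hne, heq⟩ := Fintype.exists_ne_map_eq_of_card_lt tok hcard
  have hS : ∀ g, ∀ c ∈ word g, c ∈ S₀ := by
    intro g c hc
    rcases hword g c hc with rfl | rfl <;> assumption
  have hS' : ∀ g', ∀ c ∈ word g' ++ chash :: (word g).reverse, c ∈ S₀ := by
    intro g' c hc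
    simp only [List.mem_append, List.mem_cons, List.mem_reverse] at hc
    rcases hc with hc | rfl | hc
    exacts [hS g' c hc, hh, hS g c hc]
  have hacc := (hdec _ (hS' g)).2.1.2 ⟨word g, hword g, rfl⟩
  rcases sumAccepts_append_or hN (hlen g) (htok g _) (heq ▸ htok g' _) hacc with h | h
  · obtain ⟨w, -, hw⟩ := (hdec (word g ++ []) (by simpa using hS g)).2.1.1 (h [])
    have hmem : chash ∈ word g := by
      rw [List.append_nil] at hw
      rw [hw]
      simp
    rcases hword g _ hmem with e | e
    exacts [h0h e.symm, h1h e.symm]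
  · obtain ⟨w, -, hw⟩ := (hdec _ (hS' g')).2.1.1 h
    have hl := congrArg List.length hw
    simp only [List.length_append, List.length_cons, List.length_reverse, hlen] at hl
    obtain ⟨h₁, h₂⟩ := List.append_inj hw (by rw [hlen]; omega)
    have h₃ := List.reverse_injective (List.cons.inj h₂).2
    exact hne (hinj (h₃.trans h₁.symm))
end

section
/- For every input x ∈ Σ* with |x| ≥ 1, if the appending-style system halts on x, then it halts within |Σ|^{|x|} steps; equivalently, if the system performs more than |Σ|^{|x|} steps without halting, then it never halts. -/
/-!
The appending-style context-management system.

The alphabet is a finite type `A` with a designated halting set `H ⊆ A`.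
`N ≥ 1` is the context-window length, and `f : List A → A` abstracts one
decoding step of a fixed finite-precision Transformer with a deterministic
decoding rule (the system only ever evaluates `f` on strings of length at
most `N`).
-/

variable {A : Type} [DecidableEq A]

/-- One step of the appending-style system: decode
`x̂ = f w` where `w` is the prefix of `r` of length `min |r| N`; halt (`none`)
if `x̂ ∈ H`, and otherwise delete the first token of `r` and append `x̂`. -/
def appStep (N : ℕ) (H : Finset A) (f : List A → A) (r : List A) :
    Option (List A) :=
  if f (r.take (min r.length N)) ∈ H then none
  else some (r.drop 1 ++ [f (r.take (min r.length N))])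

/-- `appTraj N H f x t` is the maintained string `r⁽ᵗ⁺¹⁾` (so index `0`
corresponds to `r⁽¹⁾ = x`), or `none` if the system has halted by then. -/
def appTraj (N : ℕ) (H : Finset A) (f : List A → A) (x : List A) :
    ℕ → Option (List A)
  | 0 => some x
  | t + 1 => (appTraj N H f x t).bind (appStep N H f)

theorem appTraj_add_eq_none {N : ℕ} {H : Finset A} {f : List A → A} {x : List A} {t : ℕ}
    (h : appTraj N H f x t = none) (k : ℕ) : appTraj N H f x (t + k) = none := by
  induction k with
  | zero => exact h
  | succ k ih => rw [← add_assoc, appTraj, ih, Option.bind_none]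

theorem appTraj_add_congr {N : ℕ} {H : Finset A} {f : List A → A} {x : List A} {i j : ℕ}
    (h : appTraj N H f x i = appTraj N H f x j) (k : ℕ) :
    appTraj N H f x (i + k) = appTraj N H f x (j + k) := by
  induction k with
  | zero => exact h
  | succ k ih => rw [← add_assoc, ← add_assoc, appTraj, appTraj, ih]

theorem appTraj_add_mul_period {N : ℕ} {H : Finset A} {f : List A → A} {x : List A} {i p : ℕ}
    (h : appTraj N H f x (i + p) = appTraj N H f x i) (n : ℕ) :
    appTraj N H f x (i + n * p) = appTraj N H f x i := by
  induction n with
  | zero => simp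
  | succ n ih =>
    rw [← ih, add_one_mul, add_comm (n * p) p, ← add_assoc]
    exact appTraj_add_congr h _

theorem length_of_appStep_eq_some {N : ℕ} {H : Finset A} {f : List A → A} {r s : List A}
    (hr : 1 ≤ r.length) (h : appStep N H f r = some s) : s.length = r.length := by
  unfold appStep at h
  split_ifs at h
  obtain rfl := Option.some.inj h
  simp only [List.length_append, List.length_drop, List.length_singleton]
  omega

theorem length_of_appTraj_eq_some {N : ℕ} {H : Finset A} {f : List A → A} {x : List A}
    (hx : 1 ≤ x.length) {t : ℕ} {r : List A} (h : appTraj N H f x t = some r) :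
    r.length = x.length := by
  induction t generalizing r with
  | zero => rw [← Option.some.inj h]
  | succ t ih =>
    obtain ⟨s, hs, hr⟩ := Option.bind_eq_some_iff.mp h
    rw [length_of_appStep_eq_some ((ih hs).symm ▸ hx) hr, ih hs]

/-- A halting trajectory does not revisit a string: otherwise it would be periodic. -/
theorem appTraj_ne_of_lt {N : ℕ} {H : Finset A} {f : List A → A} {x : List A} {i j : ℕ}
    (hhalt : ∃ t, appTraj N H f x t = none) (hi : appTraj N H f x i ≠ none) (hij : i < j) :
    appTraj N H f x i ≠ appTraj N H f x j := by
  intro h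
  obtain ⟨T, hT⟩ := hhalt
  obtain ⟨p, rfl⟩ := Nat.exists_eq_add_of_lt hij
  rw [add_assoc] at h
  apply hi
  rw [← appTraj_add_mul_period h.symm T,
    show i + T * (p + 1) = T + (i + T * p) by ring]
  exact appTraj_add_eq_none hT _

/-- For every input `x` with `|x| ≥ 1`, if the appending-style
system halts on `x`, then it halts within `|Σ| ^ |x|` steps (equivalently, if it
performs more than `|Σ| ^ |x|` steps without halting, it never halts). -/
theorem appending_system_halting_bound
    (A : Type) [Fintype A] [DecidableEq A] (H : Finset A)
    (N : ℕ) (hN : 1 ≤ N) (f : List A → A)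
    (x : List A) (hx : 1 ≤ x.length)
    (hhalt : ∃ t, appTraj N H f x t = none) :
    ∃ t ≤ Fintype.card A ^ x.length, appTraj N H f x t = none := by
  refine ⟨_, le_rfl, ?_⟩
  by_contra hK
  have hne (i : Fin (Fintype.card A ^ x.length + 1)) : appTraj N H f x i ≠ none := fun h =>
    hK (by simpa [Nat.add_sub_cancel' (Nat.le_of_lt_succ i.isLt)] using
      appTraj_add_eq_none h (Fintype.card A ^ x.length - i))
  choose r hr using fun i => Option.ne_none_iff_exists'.mp (hne i)
  let g (i : Fin (Fintype.card A ^ x.length + 1)) : List.Vector A x.length :=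
    ⟨r i, length_of_appTraj_eq_some hx (hr i)⟩
  obtain ⟨i, j, hij, hg⟩ := Fintype.exists_ne_map_eq_of_card_lt g (by simp [card_vector])
  have heq : appTraj N H f x i = appTraj N H f x j := by
    rw [hr, hr, show r i = r j from congrArg Subtype.val hg]
  rcases lt_or_gt_of_ne hij with hlt | hlt
  · exact appTraj_ne_of_lt hhalt (hne i) hlt heq
  · exact appTraj_ne_of_lt hhalt (hne j) hlt heq.symm
end

section
/- For every integer K ≥ 1 and every function F : Σ × Σ → Σ, where Σ = {1,…,K}, there exist a hidden dimension m ≥ 1 and matrices W_Q^{(prev)}, W_Q^{(self)}, W_K^{(prev)}, W_K^{(self)}, W_V^{(prev)}, W_V^{(self)} ∈ ℝ^{d×K}, W_O ∈ ℝ^{2K×d}, W₁ ∈ ℝ^{d×m}, b₁ ∈ ℝ^m, W₂ ∈ ℝ^{m×d}, W ∈ ℝ^{d×K}, such that for every pair (a, b) ∈ Σ², the logit row y₂ of the specified one-layer two-head decoder-only Transformer on input (a, b) satisfies y₂(k) = 1 if k = F(a, b) and y₂(k) = 0 otherwise; in particular the maximizer of y₂ is unique and greedy decoding outputs F(a, b).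 -/
/-!
A one-layer, two-head decoder-only Transformer with context window 2.

The token alphabet is `Fin K` (identified with `{1, …, K}`), and the model
dimension is `d = 3K + K²`; we index the `d` coordinates by the block type
`TIdx K = Fin K ⊕ (Fin K ⊕ (Fin K ⊕ Fin K × Fin K))`, i.e. a token block of
size `K`, a feature block of size `2K` (split into its two `K`-sized halves),
and a pair block of size `K²`.
-/

open Matrix

/-- Index type for the `d = 3K + K²` coordinates, in blocks of sizes
`K`, `K`, `K`, `K²`. -/
abbrev TIdx (K : ℕ) : Type := Fin K ⊕ (Fin K ⊕ (Fin K ⊕ Fin K × Fin K))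

/-- The embedding of token `a`: the row vector `(e_a; 0_{2K}; 0_{K²})`. -/
def emb (K : ℕ) (a : Fin K) : TIdx K → ℝ
  | Sum.inl j => if j = a then 1 else 0
  | Sum.inr _ => 0

/-- The output (at position 2) of one softmax attention head with parameter
matrices `WQ, WK, WV ∈ ℝ^{d × K}` on the input pair `(a, b)`:
queries/keys/values are obtained from the embeddings `x₁ = emb a`,
`x₂ = emb b`, attention scores are scaled by `1/√K`, and the output is the
softmax-weighted combination of the two values. -/
noncomputable def headOut (K : ℕ) (WQ WKm WV : Matrix (TIdx K) (Fin K) ℝ)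
    (a b : Fin K) : Fin K → ℝ :=
  let q := Matrix.vecMul (emb K b) WQ
  let k₁ := Matrix.vecMul (emb K a) WKm
  let k₂ := Matrix.vecMul (emb K b) WKm
  let v₁ := Matrix.vecMul (emb K a) WV
  let v₂ := Matrix.vecMul (emb K b) WV
  let s₁ := Real.exp (q ⬝ᵥ k₁ / Real.sqrt K)
  let s₂ := Real.exp (q ⬝ᵥ k₂ / Real.sqrt K)
  (s₁ / (s₁ + s₂)) • v₁ + (s₂ / (s₁ + s₂)) • v₂

/-- The logit row `y₂` at position 2 of the one-layer, two-head decoder-only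
Transformer on input `(a, b)`: two attention heads (`prev` and `self`) whose
concatenated outputs are projected by `W_O ∈ ℝ^{2K × d}` and added residually
to `x₂`, followed by a ReLU feed-forward layer `(W₁, b₁, W₂)` with a residual
connection, and a classification head `W ∈ ℝ^{d × K}`. -/
noncomputable def logits (K m : ℕ)
    (WQp WKp WVp WQs WKs WVs : Matrix (TIdx K) (Fin K) ℝ)
    (WO : Matrix (Fin K ⊕ Fin K) (TIdx K) ℝ)
    (W₁ : Matrix (TIdx K) (Fin m) ℝ) (b₁ : Fin m → ℝ)
    (W₂ : Matrix (Fin m) (TIdx K) ℝ)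
    (W : Matrix (TIdx K) (Fin K) ℝ)
    (a b : Fin K) : Fin K → ℝ :=
  let oprev := headOut K WQp WKp WVp a b
  let oself := headOut K WQs WKs WVs a b
  let z := emb K b + Matrix.vecMul (Sum.elim oprev oself) WO
  let x' := z + Matrix.vecMul (fun j => max (Matrix.vecMul z W₁ j + b₁ j) 0) W₂
  Matrix.vecMul x' W

/-- Multiplying an embedding by a matrix selects the row of the token. -/
lemma vecMul_emb {K : ℕ} {n : Type*} (a : Fin K) (M : Matrix (TIdx K) n ℝ) :
    Matrix.vecMul (emb K a) M = M (Sum.inl a) := by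
  ext j
  simp [Matrix.vecMul, dotProduct, emb]

/-- A head with zero queries averages the two values. -/
lemma headOut_zero_query {K : ℕ} (WKm WV : Matrix (TIdx K) (Fin K) ℝ) (a b : Fin K) :
    headOut K 0 WKm WV a b
      = (1 / 2 : ℝ) • WV (Sum.inl a) + (1 / 2 : ℝ) • WV (Sum.inl b) := by
  simp only [headOut, vecMul_emb]
  have h : (0 : Matrix (TIdx K) (Fin K) ℝ) (Sum.inl b) = 0 := rfl
  norm_num [h]

/-- The conjunction of two propositions as a single ReLU unit. -/
lemma relu_indicator_add_indicator_sub_one (p q : Prop) [Decidable p] [Decidable q] :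
    max ((if p then (1 : ℝ) else 0) + (if q then 1 else 0) - 1) 0 = if p ∧ q then 1 else 0 := by
  by_cases hp : p <;> by_cases hq : q <;> simp [hp, hq]

/-- Values of the `prev` head: twice the token block, so that uniform attention yields
`e_a + e_b`. -/
def prevValue (K : ℕ) : Matrix (TIdx K) (Fin K) ℝ :=
  fun i k => Sum.elim (fun j => if k = j then 2 else 0) (fun _ => 0) i

/-- The output projection writes the `prev` head into the first half of the feature block. -/
def outProj (K : ℕ) : Matrix (Fin K ⊕ Fin K) (TIdx K) ℝ :=
  fun i t => Sum.elim (fun j => if t = Sum.inr (Sum.inl j) then 1 else 0) (fun _ => 0) i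

/-- First feed-forward layer: the unit of the pair `p` computes the pre-activation
`(z_feature - z_token) p.1 + z_token p.2`. -/
def pairDetector (K : ℕ) : Matrix (TIdx K) (Fin (K * K)) ℝ :=
  fun t n =>
    let p := finProdFinEquiv.symm n
    Sum.elim (fun j => (if j = p.2 then 1 else 0) - if j = p.1 then 1 else 0)
      (Sum.elim (fun j => if j = p.1 then 1 else 0) (fun _ => 0)) t

/-- Second feed-forward layer: the unit of the pair `p` writes into coordinate `p` of the
pair block. -/
def pairWriter (K : ℕ) : Matrix (Fin (K * K)) (TIdx K) ℝ :=
  fun n t => if t = Sum.inr (Sum.inr (Sum.inr (finProdFinEquiv.symm n))) then 1 else 0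

/-- The classification head reads the pair block through `F`. -/
def tableHead {K : ℕ} (F : Fin K → Fin K → Fin K) : Matrix (TIdx K) (Fin K) ℝ :=
  fun t k => Sum.elim (fun _ => 0)
    (Sum.elim (fun _ => 0) (Sum.elim (fun _ => 0) (fun p => if k = F p.1 p.2 then 1 else 0))) t

/-- The residual stream after attention is `(e_b; e_a + e_b; 0; 0)`. -/
lemma emb_add_vecMul_outProj {K : ℕ} (a b : Fin K) (o : Fin K → ℝ) :
    emb K b + Matrix.vecMul (Sum.elim (headOut K 0 0 (prevValue K) a b) o) (outProj K)
      = Sum.elim (fun j => if j = b then 1 else 0)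
          (Sum.elim (fun j => (if j = a then 1 else 0) + if j = b then 1 else 0)
            (fun _ => 0)) := by
  ext t
  rcases t with j | j | j | p <;>
    simp [headOut_zero_query, Matrix.vecMul, dotProduct, emb, outProj, prevValue]

/-- The hidden units are the indicators of the pairs of tokens. -/
lemma relu_pairDetector {K : ℕ} (a b : Fin K) (n : Fin (K * K)) :
    max (Matrix.vecMul (Sum.elim (fun j => if j = b then 1 else 0)
          (Sum.elim (fun j => (if j = a then 1 else 0) + if j = b then 1 else 0)
            (fun _ => 0))) (pairDetector K) n + -1) 0
      = if n = finProdFinEquiv (a, b) then 1 else 0 := by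
  have h : n = finProdFinEquiv (a, b) ↔
      a = (finProdFinEquiv.symm n).1 ∧ b = (finProdFinEquiv.symm n).2 := by
    rw [← Equiv.symm_apply_eq, Prod.ext_iff, eq_comm, @eq_comm _ b]
  simp only [h]
  rw [← relu_indicator_add_indicator_sub_one]
  congr 1
  simp only [Matrix.vecMul, dotProduct, pairDetector, Fintype.sum_sum_type, Sum.elim_inl,
    Sum.elim_inr, add_mul, ite_mul, one_mul, zero_mul, Finset.sum_add_distrib,
    Finset.sum_ite_eq', Finset.mem_univ, if_true, Finset.sum_const_zero]
  ring

/-- **Lemma: realizing any binary token function.** For every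
`K ≥ 1` and every `F : Σ × Σ → Σ` with `Σ = {1, …, K}`, there exist a hidden
dimension `m ≥ 1` and weight matrices such that for every pair `(a, b)`, the
logit row `y₂` of the one-layer two-head decoder-only Transformer on input
`(a, b)` is the indicator of `F (a, b)`; in particular the maximizer of `y₂`
is unique and greedy decoding outputs `F (a, b)`. -/
theorem exists_transformer_computing_binary_function
    (K : ℕ) (hK : 1 ≤ K) (F : Fin K → Fin K → Fin K) :
    ∃ (m : ℕ), 1 ≤ m ∧
      ∃ (WQp WKp WVp WQs WKs WVs : Matrix (TIdx K) (Fin K) ℝ)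
        (WO : Matrix (Fin K ⊕ Fin K) (TIdx K) ℝ)
        (W₁ : Matrix (TIdx K) (Fin m) ℝ) (b₁ : Fin m → ℝ)
        (W₂ : Matrix (Fin m) (TIdx K) ℝ)
        (W : Matrix (TIdx K) (Fin K) ℝ),
        ∀ a b k : Fin K,
          (logits K m WQp WKp WVp WQs WKs WVs WO W₁ b₁ W₂ W a b k
              = if k = F a b then 1 else 0) ∧
          (k ≠ F a b →
            logits K m WQp WKp WVp WQs WKs WVs WO W₁ b₁ W₂ W a b k
              < logits K m WQp WKp WVp WQs WKs WVs WO W₁ b₁ W₂ W a b (F a b)) := by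
  have key : ∀ a b k : Fin K,
      logits K (K * K) 0 0 (prevValue K) 0 0 0 (outProj K) (pairDetector K) (fun _ => -1)
        (pairWriter K) (tableHead F) a b k = if k = F a b then 1 else 0 := by
    intro a b k
    simp only [logits, emb_add_vecMul_outProj, relu_pairDetector]
    have hw : Matrix.vecMul (fun n => if n = finProdFinEquiv (a, b) then (1 : ℝ) else 0)
        (pairWriter K) = fun t => if t = Sum.inr (Sum.inr (Sum.inr (a, b))) then 1 else 0 := by
      ext t
      simp only [Matrix.vecMul, dotProduct, ite_mul, one_mul, zero_mul, Finset.sum_ite_eq',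
        Finset.mem_univ, if_true, pairWriter, Equiv.symm_apply_apply]
    rw [hw]
    simp [Matrix.vecMul, dotProduct, tableHead]
  refine ⟨K * K, Nat.mul_pos hK hK, 0, 0, prevValue K, 0, 0, 0, outProj K, pairDetector K,
    fun _ => -1, pairWriter K, tableHead F, fun a b k => ⟨key a b k, fun hk => ?_⟩⟩
  rw [key, key, if_neg hk, if_pos rfl]
  exact one_pos
end

section
/- Let K ≥ 1, a, b ∈ {1,…,K}, and e = exp(1). Let o_prev be the softmax head output with query q = 𝟏 − e_b and let o_self be the softmax head output with query q = e_b, as defined in the context. Then (e/(e−1)) · o_prev − (1/(e−1)) · o_self = e_a and (e/(e−1)) · o_self − (1/(e−1)) · o_prev = e_b; these identities hold both when a ≠ b and when a = b. -/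
open Matrix

/-- The `a`-th standard basis vector `e_a` of `ℝ^K`. -/
def stdBasis (K : ℕ) (a : Fin K) : Fin K → ℝ := fun i => if i = a then 1 else 0

/-- The output of a softmax attention head with query `q ∈ ℝ^K` and
keys/values `k₁ = v₁ = e_a`, `k₂ = v₂ = e_b`:
`o = α₁ e_a + α₂ e_b`, where
`α_t = exp ⟨q, k_t⟩ / (exp ⟨q, k₁⟩ + exp ⟨q, k₂⟩)`.
(In the Transformer construction the query carries a factor `√K` and the
scores are divided by `√K`, so these factors cancel.) -/
noncomputable def headO (K : ℕ) (q : Fin K → ℝ) (a b : Fin K) : Fin K → ℝ :=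
  let s₁ := Real.exp (q ⬝ᵥ stdBasis K a)
  let s₂ := Real.exp (q ⬝ᵥ stdBasis K b)
  (s₁ / (s₁ + s₂)) • stdBasis K a + (s₂ / (s₁ + s₂)) • stdBasis K b

theorem dotProduct_stdBasis (K : ℕ) (q : Fin K → ℝ) (a : Fin K) :
    q ⬝ᵥ stdBasis K a = q a := by
  simp [dotProduct, _root_.stdBasis]

theorem headO_self (K : ℕ) (q : Fin K → ℝ) (a : Fin K) :
    headO K q a a = stdBasis K a := by
  simp only [headO, dotProduct_stdBasis, ← add_smul, ← add_div]
  rw [div_self (by positivity), one_smul]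

/-- With `e = exp 1`, let `o_prev` be the head output with
query `q = 𝟏 - e_b` and `o_self` the head output with query `q = e_b`. Then
`(e/(e-1)) o_prev - (1/(e-1)) o_self = e_a` and
`(e/(e-1)) o_self - (1/(e-1)) o_prev = e_b`; these identities hold both when
`a ≠ b` and when `a = b`. -/
theorem head_output_inversion (K : ℕ) (hK : 1 ≤ K) (a b : Fin K) :
    (Real.exp 1 / (Real.exp 1 - 1)) •
        headO K ((fun _ => (1 : ℝ)) - stdBasis K b) a b
      - (1 / (Real.exp 1 - 1)) • headO K (stdBasis K b) a b = stdBasis K a ∧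
    (Real.exp 1 / (Real.exp 1 - 1)) • headO K (stdBasis K b) a b
      - (1 / (Real.exp 1 - 1)) •
          headO K ((fun _ => (1 : ℝ)) - stdBasis K b) a b = stdBasis K b := by
  have hsub : Real.exp 1 - 1 ≠ 0 := by
    have := Real.add_one_lt_exp one_ne_zero
    linarith
  by_cases hab : a = b
  · subst hab
    simp only [headO_self, ← sub_smul, ← sub_div, div_self hsub, one_smul, and_self]
  · have hprev : headO K ((fun _ => (1 : ℝ)) - stdBasis K b) a b =
        (Real.exp 1 / (Real.exp 1 + 1)) • stdBasis K a +
          (1 / (Real.exp 1 + 1)) • stdBasis K b := by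
      simp only [headO, dotProduct_stdBasis]
      simp [_root_.stdBasis, hab]
    have hself : headO K (stdBasis K b) a b =
        (1 / (Real.exp 1 + 1)) • stdBasis K a +
          (Real.exp 1 / (Real.exp 1 + 1)) • stdBasis K b := by
      simp only [headO, dotProduct_stdBasis]
      simp [_root_.stdBasis, hab, add_comm 1 (Real.exp 1)]
    rw [hprev, hself]
    constructor <;> ext i <;>
      simp only [Pi.sub_apply, Pi.add_apply, Pi.smul_apply, smul_eq_mul] <;>
      field_simp <;> ring
end
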